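/- q-Airy asymptotics with scaled parameters: let α > β > 0 and γ, δ > 0 satisfy γ + δ = α − β = 1, and let z, t₁, t₂, t₃ be nonzero complex numbers (with all q-shifted factorials appearing below nonzero). Then there exists η with 0 < η < min{1, α+β, β+δ, β+γ} and constants C > 0, n₀ ∈ ℕ such that for all n ≥ n₀, | q^{n²β + n} t₁^{−n} V̆_n(q^{−nα} z; t₁ q^{−nβ}, t₂ q^{−nγ}, t₃ q^{−nδ}) − A_q(q² z/(t₁ t₂ t₃)) | ≤ C q^{ηn}; that is, V̆_n(q^{−nα}z; t₁q^{−nβ}, t₂q^{−nγ}, t₃q^{−nδ}) = t₁^n q^{−n²β−n} (A_q(q²z/(t₁t₂t₃)) + O(q^{ηn})) as n → ∞. -/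

import Mathlib

noncomputable section

open scoped BigOperators
open Finset MeasureTheory Filter Topology

/-- The finite q-shifted factorial `(a;q)_n`. -/
def qp (q a : ℝ) (n : ℕ) : ℝ := ∏ j ∈ Finset.range n, (1 - a * q ^ j)

/-- The infinite q-shifted factorial `(a;q)_∞`. -/
def qpi (q a : ℝ) : ℝ := ∏' j : ℕ, (1 - a * q ^ j)

/-- `z(x) = x + √(x²+1)`, so that `2x = z - 1/z`. -/
def zx (x : ℝ) : ℝ := x + Real.sqrt (x ^ 2 + 1)

/-- The finite q-shifted factorial `(a;q)_n` with complex argument. -/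
def qpC (q : ℝ) (a : ℂ) (n : ℕ) : ℂ := ∏ j ∈ Finset.range n, (1 - a * (q : ℂ) ^ j)

/-- The infinite q-shifted factorial `(a;q)_∞` with complex argument. -/
def qpiC (q : ℝ) (a : ℂ) : ℂ := ∏' j : ℕ, (1 - a * (q : ℂ) ^ j)

/-- The polynomial `V_n` as a function of `z` with complex parameters. -/
def VzC (q : ℝ) (t1 t2 t3 : ℂ) (n : ℕ) (z : ℂ) : ℂ :=
  (t1 / (q : ℂ)) ^ n *
    (qpC q (-(q : ℂ) ^ 2 / (t1 * t3)) n / qpC q (-(q : ℂ) ^ 2 / (t2 * t3)) n) *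
  ∑ k ∈ Finset.range (n + 1),
    qpC q ((q : ℂ) ^ (-(n : ℤ))) k * qpC q (-(q : ℂ) / (t1 * z)) k *
      qpC q ((q : ℂ) * z / t1) k /
      (qpC q (q : ℂ) k * qpC q (-(q : ℂ) ^ 2 / (t1 * t3)) k *
        qpC q (-(q : ℂ) ^ 2 / (t1 * t2)) k) *
      (-(q : ℂ) ^ (n + 2) / (t2 * t3)) ^ k

/-- The Ramanujan (q-Airy) function `A_q` with complex argument. -/
def ramanujanAqC (q : ℝ) (w : ℂ) : ℂ :=
  ∑' n : ℕ, (q : ℂ) ^ (n ^ 2) * (-w) ^ n / qpC q (q : ℂ) n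

/-- The identity behind `1 - x = -x * (1 - x⁻¹)`, applied to every factor and read backwards. -/
theorem qpC_reverse {q : ℝ} (hq : q ≠ 0) {b : ℂ} (hb : b ≠ 0) (k : ℕ) :
    qpC q b k = (-b) ^ k * (∏ j ∈ range k, (q : ℂ) ^ j) * qpC q (q * b⁻¹ / (q : ℂ) ^ k) k := by
  have hqC : (q : ℂ) ≠ 0 := by exact_mod_cast hq
  have hrev : qpC q (q * b⁻¹ / (q : ℂ) ^ k) k = ∏ j ∈ range k, (1 - (b * (q : ℂ) ^ j)⁻¹) := by
    rw [← Finset.prod_range_reflect]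
    refine Finset.prod_congr rfl fun j hj => ?_
    have hk : k = (k - 1 - j) + j + 1 := by have := Finset.mem_range.1 hj; omega
    have hpow : (q : ℂ) ^ k = (q : ℂ) ^ (k - 1 - j) * (q : ℂ) ^ j * q := by
      rw [← pow_add, ← pow_succ, ← hk]
    rw [hpow]
    field_simp
  rw [hrev, qpC, ← Finset.card_range k, ← Finset.prod_const, Finset.card_range,
    ← Finset.prod_mul_distrib, ← Finset.prod_mul_distrib]
  refine Finset.prod_congr rfl fun j _ => ?_
  field_simp
  ring

theorem prod_range_pow_sq_mul_pow (x : ℂ) (k : ℕ) :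
    (∏ j ∈ range k, x ^ j) ^ 2 * x ^ k = x ^ k ^ 2 := by
  induction k with
  | zero => simp
  | succ k ih =>
    have h : x ^ (k + 1) ^ 2 = x ^ k ^ 2 * x ^ k * x ^ (k + 1) := by
      rw [← pow_add, ← pow_add]; congr 1; ring
    rw [Finset.prod_range_succ, h, ← ih]
    ring

theorem norm_qpC_sub_one_le {q : ℝ} (hq0 : 0 < q) (hq1 : q < 1) (a : ℂ) (k : ℕ) :
    ‖qpC q a k - 1‖ ≤ Real.exp (‖a‖ / (1 - q)) - 1 := by
  have h := Finset.norm_prod_one_add_sub_one_le (range k) fun j => -(a * (q : ℂ) ^ j)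
  simp only [← sub_eq_add_neg] at h
  refine h.trans (sub_le_sub_right (Real.exp_le_exp.2 ?_) 1)
  have hs : ∑ j ∈ range k, ‖-(a * (q : ℂ) ^ j)‖ = ‖a‖ * ∑ j ∈ range k, q ^ j := by
    rw [Finset.mul_sum]
    refine Finset.sum_congr rfl fun j _ => ?_
    rw [norm_neg, norm_mul, norm_pow, Complex.norm_real, Real.norm_of_nonneg hq0.le]
  rw [hs, div_eq_mul_inv, ← tsum_geometric_of_lt_one hq0.le hq1]
  exact mul_le_mul_of_nonneg_left
    ((summable_geometric_of_lt_one hq0.le hq1).sum_le_tsum _ fun j _ => by positivity)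
    (norm_nonneg a)

theorem norm_qpC_sub_one_le_of_norm_le {q M : ℝ} (hq0 : 0 < q) (hq1 : q < 1) {a : ℂ}
    (ha : ‖a‖ ≤ M) (k : ℕ) :
    ‖qpC q a k - 1‖ ≤ Real.exp (M / (1 - q)) / (1 - q) * ‖a‖ := by
  have hq : 0 < 1 - q := by linarith
  set x := ‖a‖ / (1 - q) with hx
  have hx0 : 0 ≤ x := by positivity
  have hxM : x ≤ M / (1 - q) := div_le_div_of_nonneg_right ha hq.le
  have hexp : Real.exp x - 1 ≤ x * Real.exp x := by
    have h1 := Real.add_one_le_exp (-x)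
    have h2 : Real.exp (-x) * Real.exp x = 1 := by rw [← Real.exp_add]; simp
    nlinarith [Real.exp_pos x]
  calc ‖qpC q a k - 1‖ ≤ Real.exp x - 1 := norm_qpC_sub_one_le hq0 hq1 a k
    _ ≤ x * Real.exp x := hexp
    _ ≤ x * Real.exp (M / (1 - q)) := by gcongr
    _ = Real.exp (M / (1 - q)) / (1 - q) * ‖a‖ := by rw [hx]; ring

section CloseToOne

open Asymptotics

variable {ι : Type*} {l : Filter ι} {ε : ι → ℝ} {f g : ι → ℂ}

theorem tendsto_one_of_isBigO_sub_one (hε : Tendsto ε l (𝓝 0)) (hf : (fun i => f i - 1) =O[l] ε) :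
    Tendsto f l (𝓝 1) := by
  have := (hf.trans_tendsto hε).add_const 1
  simpa using this

theorem isBigO_mul_sub_one (hε : Tendsto ε l (𝓝 0)) (hf : (fun i => f i - 1) =O[l] ε)
    (hg : (fun i => g i - 1) =O[l] ε) : (fun i => f i * g i - 1) =O[l] ε := by
  have h1 := hf.mul ((tendsto_one_of_isBigO_sub_one hε hg).isBigO_one ℝ)
  simp only [mul_one] at h1
  refine (h1.add hg).congr_left fun i => ?_
  ring

theorem isBigO_div_sub_one (hε : Tendsto ε l (𝓝 0)) (hf : (fun i => f i - 1) =O[l] ε)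
    (hg : (fun i => g i - 1) =O[l] ε) : (fun i => f i / g i - 1) =O[l] ε := by
  have hg1 := tendsto_one_of_isBigO_sub_one hε hg
  have h1 := (hf.sub hg).mul ((hg1.inv₀ one_ne_zero).isBigO_one ℝ)
  simp only [mul_one] at h1
  refine h1.congr' ?_ EventuallyEq.rfl
  filter_upwards [hg1.eventually_ne one_ne_zero] with i hi
  field_simp
  ring

theorem isBigO_qpC_sub_one {q : ℝ} (hq0 : 0 < q) (hq1 : q < 1) (hε : Tendsto ε l (𝓝 0))
    (hf : f =O[l] ε) (κ : ι → ℕ) : (fun i => qpC q (f i) (κ i) - 1) =O[l] ε := by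
  refine IsBigO.trans (IsBigO.of_bound (Real.exp (1 / (1 - q)) / (1 - q)) ?_) hf
  have h0 : Tendsto (fun i => ‖f i‖) l (𝓝 0) := by
    simpa using (hf.trans_tendsto hε).norm
  filter_upwards [h0.eventually_le_const one_pos] with i hi
  exact norm_qpC_sub_one_le_of_norm_le hq0 hq1 hi _

end CloseToOne

theorem qpC_self_ne_zero {q : ℝ} (hq0 : 0 < q) (hq1 : q < 1) (k : ℕ) : qpC q (q : ℂ) k ≠ 0 := by
  refine Finset.prod_ne_zero_iff.2 fun j _ h => ?_
  have h1 : ((q ^ (j + 1) : ℝ) : ℂ) = ((1 : ℝ) : ℂ) := by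
    push_cast
    rw [pow_succ']
    exact (sub_eq_zero.1 h).symm
  exact (pow_lt_one₀ hq0.le hq1 j.succ_ne_zero).ne (Complex.ofReal_injective h1)

/-- The terms of the `q`-Airy series decay fast enough to absorb a factor `q⁻ᵏ`. -/
theorem summable_norm_ramanujanAqC_term_div {q : ℝ} (hq0 : 0 < q) (hq1 : q < 1) {w : ℂ}
    (hw : w ≠ 0) :
    Summable fun k : ℕ => ‖(q : ℂ) ^ (k ^ 2) * (-w) ^ k / qpC q (q : ℂ) k‖ / q ^ k := by
  have hqC : (q : ℂ) ≠ 0 := by exact_mod_cast hq0.ne'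
  have hne := qpC_self_ne_zero hq0 hq1
  have hpos : ∀ k : ℕ, 0 < ‖(q : ℂ) ^ (k ^ 2) * (-w) ^ k / qpC q (q : ℂ) k‖ / q ^ k := fun k =>
    div_pos (norm_pos_iff.2 (div_ne_zero (mul_ne_zero (pow_ne_zero _ hqC)
      (pow_ne_zero _ (neg_ne_zero.2 hw))) (hne k))) (pow_pos hq0 k)
  have hq2 : Tendsto (fun k : ℕ => (q : ℂ) ^ k) atTop (𝓝 0) :=
    tendsto_pow_atTop_nhds_zero_of_norm_lt_one (by
      rwa [Complex.norm_real, Real.norm_of_nonneg hq0.le])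
  have hlim : Tendsto (fun k : ℕ => ‖(q : ℂ) ^ k * (q : ℂ) ^ k * w / (1 - q * (q : ℂ) ^ k)‖)
      atTop (𝓝 0) := by
    have h1 := (((hq2.mul hq2).mul_const w).div ((hq2.const_mul (q : ℂ)).const_sub 1)
      (by simp)).norm
    simpa using h1
  refine summable_of_ratio_test_tendsto_lt_one zero_lt_one
    (Eventually.of_forall fun k => (hpos k).ne') (hlim.congr fun k => ?_)
  rw [Real.norm_of_nonneg (hpos _).le, Real.norm_of_nonneg (hpos _).le, eq_div_iff (hpos k).ne',
    mul_div_assoc', ← norm_mul, div_eq_div_iff (by positivity) (by positivity)]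
  have hk : (1 - q * (q : ℂ) ^ k) ≠ 0 := by
    have h := hne (k + 1)
    rw [qpC, Finset.prod_range_succ] at h
    exact right_ne_zero_of_mul h
  have hS : qpC q (q : ℂ) (k + 1) = qpC q (q : ℂ) k * (1 - q * (q : ℂ) ^ k) :=
    Finset.prod_range_succ _ _
  have hp : (q : ℂ) ^ ((k + 1) ^ 2) = (q : ℂ) ^ (k ^ 2) * ((q : ℂ) ^ k * (q : ℂ) ^ k * q) := by
    rw [← pow_add, ← pow_succ, ← pow_add]; congr 1; ring
  have hmain : (q : ℂ) ^ k * (q : ℂ) ^ k * w / (1 - q * (q : ℂ) ^ k) *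
      ((q : ℂ) ^ (k ^ 2) * (-w) ^ k / qpC q (q : ℂ) k) * q =
      -((q : ℂ) ^ ((k + 1) ^ 2) * (-w) ^ (k + 1) / qpC q (q : ℂ) (k + 1)) := by
    rw [hS, hp, pow_succ (-w)]
    have := hne k
    field_simp
  have hn := congrArg norm hmain
  rw [norm_neg, norm_mul _ (q : ℂ), Complex.norm_real, Real.norm_of_nonneg hq0.le] at hn
  rw [← hn, pow_succ]
  ring

theorem norm_mul_sub_one_le {a b : ℂ} {s t : ℝ} (ha : ‖a - 1‖ ≤ s) (hb : ‖b - 1‖ ≤ t) :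
    ‖a * b - 1‖ ≤ s * (1 + t) + t := by
  have hb' : ‖b‖ ≤ 1 + t := by
    calc ‖b‖ = ‖1 + (b - 1)‖ := by ring_nf
      _ ≤ ‖(1 : ℂ)‖ + ‖b - 1‖ := norm_add_le _ _
      _ ≤ 1 + t := by rw [norm_one]; linarith
  calc ‖a * b - 1‖ = ‖(a - 1) * b + (b - 1)‖ := by ring_nf
    _ ≤ ‖a - 1‖ * ‖b‖ + ‖b - 1‖ := (norm_add_le _ _).trans_eq (by rw [norm_mul])
    _ ≤ s * (1 + t) + t :=
      add_le_add (mul_le_mul ha hb' (norm_nonneg _) ((norm_nonneg _).trans ha)) hb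

/-- Comparison of a truncated and perturbed series with the full series. -/
theorem norm_sum_mul_sub_tsum_le {q : ℝ} (hq0 : 0 < q) (hq1 : q < 1) {c g : ℕ → ℂ}
    (hc : Summable fun k => ‖c k‖ / q ^ k) {n : ℕ} {K e : ℝ} (hK : 0 ≤ K) (he : q ^ n ≤ e)
    (hg : ∀ k ≤ n, ‖g k - 1‖ ≤ K * (e / q ^ k)) :
    ‖∑ k ∈ range (n + 1), c k * g k - ∑' k, c k‖ ≤ (K + 1) * e * ∑' k, ‖c k‖ / q ^ k := by
  have he0 : 0 < e := (pow_pos hq0 n).trans_le he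
  have hcs : Summable c := by
    refine Summable.of_norm_bounded hc fun k => ?_
    rw [le_div_iff₀ (pow_pos hq0 k)]
    exact mul_le_of_le_one_right (norm_nonneg _) (pow_le_one₀ hq0.le hq1.le)
  have hfin : HasSum (fun k => if k ∈ range (n + 1) then c k * g k else 0)
      (∑ k ∈ range (n + 1), c k * g k) := by
    have h := hasSum_sum_of_ne_finset_zero (L := SummationFilter.unconditional ℕ)
      (f := fun k => if k ∈ range (n + 1) then c k * g k else 0)
      (s := range (n + 1)) fun k hk => if_neg hk
    rwa [Finset.sum_congr rfl fun k hk => if_pos hk] at h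
  rw [← (hfin.sub hcs.hasSum).tsum_eq]
  refine tsum_of_norm_bounded (hc.hasSum.mul_left ((K + 1) * e)) fun k => ?_
  have hqk : 0 < q ^ k := pow_pos hq0 k
  have hgoal : (K + 1) * e * (‖c k‖ / q ^ k) = ‖c k‖ * ((K + 1) * (e / q ^ k)) := by ring
  rw [hgoal]
  split_ifs with hk
  · have hk' : k ≤ n := Nat.lt_succ_iff.1 (Finset.mem_range.1 hk)
    rw [← mul_sub_one, norm_mul]
    refine mul_le_mul_of_nonneg_left ((hg k hk').trans ?_) (norm_nonneg _)
    gcongr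
    linarith
  · have hk' : n ≤ k := by rw [Finset.mem_range] at hk; omega
    rw [zero_sub, norm_neg]
    refine le_mul_of_one_le_right (norm_nonneg _) ?_
    have h1 : 1 ≤ e / q ^ k := by
      rw [one_le_div hqk]
      exact (pow_le_pow_of_le_one hq0.le hq1.le hk').trans he
    nlinarith

theorem qpC_inv_mul_qpC_mul_pow {q : ℝ} (hq : q ≠ 0) {x w : ℂ} (hx : x ≠ 0) (hw : w ≠ 0)
    (s : ℂ) (k : ℕ) :
    qpC q x⁻¹ k * qpC q (q * w / x) k * (x ^ 2 * s) ^ k =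
      (q : ℂ) ^ (k ^ 2) * (w * s) ^ k *
        (qpC q (q * (x / (q : ℂ) ^ k)) k * qpC q (w⁻¹ * (x / (q : ℂ) ^ k)) k) := by
  have hqC : (q : ℂ) ≠ 0 := by exact_mod_cast hq
  have e1 : (q : ℂ) * x⁻¹⁻¹ / (q : ℂ) ^ k = q * (x / (q : ℂ) ^ k) := by
    rw [inv_inv, mul_div_assoc]
  have e2 : (q : ℂ) * (q * w / x)⁻¹ / (q : ℂ) ^ k = w⁻¹ * (x / (q : ℂ) ^ k) := by
    field_simp
  have e3 : (-x⁻¹) ^ k * (-(q * w / x)) ^ k * (x ^ 2 * s) ^ k = (q : ℂ) ^ k * (w * s) ^ k := by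
    rw [← mul_pow, ← mul_pow, ← mul_pow]
    congr 1
    field_simp
  rw [qpC_reverse hq (inv_ne_zero hx), qpC_reverse hq (div_ne_zero (mul_ne_zero hqC hw) hx),
    e1, e2, ← prod_range_pow_sq_mul_pow]
  linear_combination (∏ j ∈ range k, (q : ℂ) ^ j) ^ 2 * qpC q (q * (x / (q : ℂ) ^ k)) k *
    qpC q (w⁻¹ * (x / (q : ℂ) ^ k)) k * e3

theorem norm_qpC_mul_qpC_sub_one_le {q : ℝ} (hq0 : 0 < q) (hq1 : q < 1) (v : ℂ) :
    ∃ K : ℝ, 0 ≤ K ∧ ∀ u : ℂ, ‖u‖ ≤ 1 → ∀ k : ℕ,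
      ‖qpC q (q * u) k * qpC q (v * u) k - 1‖ ≤ K * ‖u‖ := by
  have hq : 0 < 1 - q := by linarith
  have key : ∀ b : ℂ, ∃ K : ℝ, 0 ≤ K ∧ ∀ u : ℂ, ‖u‖ ≤ 1 → ∀ k : ℕ,
      ‖qpC q (b * u) k - 1‖ ≤ K * ‖u‖ := fun b => by
    refine ⟨Real.exp (‖b‖ / (1 - q)) / (1 - q) * ‖b‖, by positivity, fun u hu k => ?_⟩
    have hb : ‖b * u‖ ≤ ‖b‖ := by
      rw [norm_mul]; exact mul_le_of_le_one_right (norm_nonneg _) hu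
    refine (norm_qpC_sub_one_le_of_norm_le hq0 hq1 hb k).trans_eq ?_
    rw [norm_mul, mul_assoc]
  obtain ⟨K₁, h₁, hK₁⟩ := key q
  obtain ⟨K₂, h₂, hK₂⟩ := key v
  refine ⟨K₁ * (1 + K₂) + K₂, by positivity, fun u hu k => ?_⟩
  refine (norm_mul_sub_one_le (hK₁ u hu k) (hK₂ u hu k)).trans ?_
  have := norm_nonneg u
  have h3 : K₁ * ‖u‖ * (K₂ * ‖u‖) ≤ K₁ * ‖u‖ * (K₂ * 1) := by gcongr
  nlinarith

theorem isBigO_rpow_scaled {q η s : ℝ} (hq0 : 0 < q) (hq1 : q < 1) (hs : η ≤ s) (c : ℂ)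
    {v : ℕ → ℂ} (hv : ∀ n : ℕ, v n = c * ((q ^ ((n : ℝ) * s) : ℝ) : ℂ)) :
    v =O[atTop] fun n : ℕ => q ^ (η * n) := by
  refine Asymptotics.IsBigO.of_bound ‖c‖ (Eventually.of_forall fun n => ?_)
  rw [hv, norm_mul, Complex.norm_real, Real.norm_of_nonneg (by positivity),
    Real.norm_of_nonneg (by positivity)]
  refine mul_le_mul_of_nonneg_left ?_ (norm_nonneg _)
  refine Real.rpow_le_rpow_of_exponent_ge hq0 hq1.le ?_
  rw [mul_comm]
  exact mul_le_mul_of_nonneg_left hs n.cast_nonneg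

theorem tendsto_rpow_mul_natCast {q η : ℝ} (hq0 : 0 < q) (hq1 : q < 1) (hη : 0 < η) :
    Tendsto (fun n : ℕ => q ^ (η * n)) atTop (𝓝 0) := by
  simp only [Real.rpow_mul hq0.le, Real.rpow_natCast]
  exact tendsto_pow_atTop_nhds_zero_of_lt_one (Real.rpow_nonneg hq0.le _)
    (Real.rpow_lt_one hq0.le hq1 hη)

theorem qAiry_asymptotics_scaled_parameters
    (q : ℝ) (hq0 : 0 < q) (hq1 : q < 1)
    (α β γ δ : ℝ) (hαβ : β < α) (hβ : 0 < β) (hγ : 0 < γ) (hδ : 0 < δ)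
    (hγδ : γ + δ = 1) (hαβ1 : α - β = 1)
    (z t1 t2 t3 : ℂ) (hz : z ≠ 0) (ht1 : t1 ≠ 0) (ht2 : t2 ≠ 0) (ht3 : t3 ≠ 0)
    (hne : ∀ n k : ℕ,
      qpC q (-(q : ℂ) ^ 2 /
        ((t1 * ((q ^ (-(n : ℝ) * β) : ℝ) : ℂ)) * (t2 * ((q ^ (-(n : ℝ) * γ) : ℝ) : ℂ)))) k ≠ 0 ∧
      qpC q (-(q : ℂ) ^ 2 /
        ((t1 * ((q ^ (-(n : ℝ) * β) : ℝ) : ℂ)) * (t3 * ((q ^ (-(n : ℝ) * δ) : ℝ) : ℂ)))) k ≠ 0 ∧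
      qpC q (-(q : ℂ) ^ 2 /
        ((t2 * ((q ^ (-(n : ℝ) * γ) : ℝ) : ℂ)) * (t3 * ((q ^ (-(n : ℝ) * δ) : ℝ) : ℂ)))) k ≠ 0) :
    ∃ η : ℝ, 0 < η ∧ η < min (min 1 (α + β)) (min (β + δ) (β + γ)) ∧
      ∃ C : ℝ, 0 < C ∧ ∃ n₀ : ℕ, ∀ n : ℕ, n₀ ≤ n →
        ‖((q ^ ((n : ℝ) ^ 2 * β + (n : ℝ)) : ℝ) : ℂ) * t1 ^ (-(n : ℤ)) *
            VzC q (t1 * ((q ^ (-(n : ℝ) * β) : ℝ) : ℂ))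
              (t2 * ((q ^ (-(n : ℝ) * γ) : ℝ) : ℂ))
              (t3 * ((q ^ (-(n : ℝ) * δ) : ℝ) : ℂ)) n
              (((q ^ (-(n : ℝ) * α) : ℝ) : ℂ) * z) -
          ramanujanAqC q ((q : ℂ) ^ 2 * z / (t1 * t2 * t3))‖ ≤ C * q ^ (η * n) := by
  have hqC : (q : ℂ) ≠ 0 := by exact_mod_cast hq0.ne'
  set m := min (min 1 (α + β)) (min (β + δ) (β + γ))
  have hm0 : 0 < m := by
    refine lt_min (lt_min one_pos ?_) (lt_min ?_ ?_) <;> linarith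
  have hm1 : m ≤ 1 := (min_le_left _ _).trans (min_le_left _ _)
  have hm2 : m ≤ α + β := (min_le_left _ _).trans (min_le_right _ _)
  have hm3 : m ≤ β + δ := (min_le_right _ _).trans (min_le_left _ _)
  have hm4 : m ≤ β + γ := (min_le_right _ _).trans (min_le_right _ _)
  obtain ⟨η, hη0, hηm⟩ := exists_between hm0
  refine ⟨η, hη0, hηm, ?_⟩
  have hrpow : ∀ x : ℝ, ((q ^ x : ℝ) : ℂ) ≠ 0 := fun x => by
    exact_mod_cast (Real.rpow_pos_of_pos hq0 x).ne'
  have hsplit : ∀ (n : ℕ) (x y : ℝ), ((q ^ ((n : ℝ) * (x + y)) : ℝ) : ℂ) *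
      ((q ^ (-(n : ℝ) * x) : ℝ) : ℂ) * ((q ^ (-(n : ℝ) * y) : ℝ) : ℂ) = 1 := fun n x y => by
    rw [← Complex.ofReal_mul, ← Complex.ofReal_mul, ← Real.rpow_add hq0, ← Real.rpow_add hq0]
    ring_nf
    simp
  have hpair : ∀ (a s t : ℂ) (_ : s ≠ 0) (_ : t ≠ 0) (x y : ℝ) (n : ℕ),
      a / ((s * ((q ^ (-(n : ℝ) * x) : ℝ) : ℂ)) * (t * ((q ^ (-(n : ℝ) * y) : ℝ) : ℂ))) =
        a / (s * t) * ((q ^ ((n : ℝ) * (x + y)) : ℝ) : ℂ) := fun a s t hs ht x y n => by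
    have h1 := hrpow (-(n : ℝ) * x)
    have h2 := hrpow (-(n : ℝ) * y)
    rw [div_mul_eq_mul_div, div_eq_div_iff (by positivity) (by positivity)]
    linear_combination (-a * s * t) * hsplit n x y
  set ε : ℕ → ℝ := fun n => q ^ (η * n) with hε
  set l : Filter (ℕ × ℕ) := atTop ×ˢ 𝓟 Set.univ
  have hεl : Tendsto (fun p : ℕ × ℕ => ε p.1) l (𝓝 0) :=
    (tendsto_rpow_mul_natCast hq0 hq1 hη0).comp tendsto_fst
  have hclose : ∀ (a s t : ℂ) (_ : s ≠ 0) (_ : t ≠ 0) (x y : ℝ) (_ : m ≤ x + y)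
      (κ : ℕ × ℕ → ℕ), (fun p : ℕ × ℕ => qpC q (a / ((s * ((q ^ (-(p.1 : ℝ) * x) : ℝ) : ℂ)) *
        (t * ((q ^ (-(p.1 : ℝ) * y) : ℝ) : ℂ)))) (κ p) - 1) =O[l] fun p => ε p.1 :=
    fun a s t hs ht x y hxy κ => isBigO_qpC_sub_one hq0 hq1 hεl
      ((isBigO_rpow_scaled hq0 hq1 (hηm.le.trans hxy) _ (hpair a s t hs ht x y)).comp_tendsto
        tendsto_fst) κ
  have hA := hclose (-(q : ℂ) ^ 2) t1 t3 ht1 ht3 β δ hm3 Prod.fst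
  have hB := hclose (-(q : ℂ) ^ 2) t2 t3 ht2 ht3 γ δ (hm1.trans_eq hγδ.symm) Prod.fst
  have hX := hclose (-(q : ℂ)) t1 z ht1 hz β α (hm2.trans_eq (add_comm _ _)) Prod.snd
  have hD := hclose (-(q : ℂ) ^ 2) t1 t3 ht1 ht3 β δ hm3 Prod.snd
  have hE := hclose (-(q : ℂ) ^ 2) t1 t2 ht1 ht2 β γ hm4 Prod.snd
  obtain ⟨K, hK, hR⟩ := (isBigO_mul_sub_one hεl (isBigO_div_sub_one hεl hA hB)
    (isBigO_div_sub_one hεl hX (isBigO_mul_sub_one hεl hD hE))).exists_pos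
  obtain ⟨n₀, hn₀⟩ := eventually_atTop.1 (eventually_prod_principal_iff.1 hR.bound)
  obtain ⟨L, hL, hY⟩ := norm_qpC_mul_qpC_sub_one_le hq0 hq1 (z / t1)⁻¹
  have hW : (q : ℂ) ^ 2 * z / (t1 * t2 * t3) ≠ 0 := by positivity
  have hsum := summable_norm_ramanujanAqC_term_div hq0 hq1 hW
  set S := ∑' k : ℕ, ‖(q : ℂ) ^ (k ^ 2) * (-((q : ℂ) ^ 2 * z / (t1 * t2 * t3))) ^ k /
    qpC q (q : ℂ) k‖ / q ^ k
  have hS0 : 0 ≤ S := tsum_nonneg fun k => by positivity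
  refine ⟨(K * (1 + L) + L + 1) * S + 1, by positivity, n₀, fun n hn => ?_⟩
  have hεn : 0 < ε n := Real.rpow_pos_of_pos hq0 _
  have hqε : q ^ n ≤ ε n := by
    rw [hε, ← Real.rpow_natCast]
    refine Real.rpow_le_rpow_of_exponent_ge hq0 hq1.le ?_
    exact mul_le_of_le_one_left n.cast_nonneg (hηm.le.trans hm1)
  have hpre : ((q ^ ((n : ℝ) ^ 2 * β + (n : ℝ)) : ℝ) : ℂ) * t1 ^ (-(n : ℤ)) *
      (t1 * ((q ^ (-(n : ℝ) * β) : ℝ) : ℂ) / (q : ℂ)) ^ n = 1 := by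
    have h1 : q ^ ((n : ℝ) ^ 2 * β + (n : ℝ)) * (q ^ (-(n : ℝ) * β)) ^ n = q ^ n := by
      rw [← Real.rpow_natCast (q ^ (-(n : ℝ) * β)), ← Real.rpow_mul hq0.le, ← Real.rpow_add hq0,
        ← Real.rpow_natCast q]
      ring_nf
    have h2 : ((q ^ ((n : ℝ) ^ 2 * β + (n : ℝ)) : ℝ) : ℂ) *
        ((q ^ (-(n : ℝ) * β) : ℝ) : ℂ) ^ n = (q : ℂ) ^ n := by
      rw [← Complex.ofReal_pow, ← Complex.ofReal_mul, h1, Complex.ofReal_pow]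
    rw [zpow_neg, zpow_natCast, div_pow, mul_pow, mul_div_assoc', mul_comm (t1 ^ n),
      mul_mul_mul_comm, h2, inv_mul_cancel₀ (pow_ne_zero n ht1), mul_one,
      div_self (pow_ne_zero n hqC)]
  have hwq : (q : ℂ) * (((q ^ (-(n : ℝ) * α) : ℝ) : ℂ) * z) /
      (t1 * ((q ^ (-(n : ℝ) * β) : ℝ) : ℂ)) = q * (z / t1) / (q : ℂ) ^ n := by
    have h1 : q ^ (-(n : ℝ) * α) * q ^ n = q ^ (-(n : ℝ) * β) := by
      rw [← Real.rpow_natCast q n, ← Real.rpow_add hq0, sub_eq_iff_eq_add.1 hαβ1]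
      ring_nf
    have h2 : ((q ^ (-(n : ℝ) * α) : ℝ) : ℂ) * (q : ℂ) ^ n = ((q ^ (-(n : ℝ) * β) : ℝ) : ℂ) := by
      exact_mod_cast h1
    have h3 := hrpow (-(n : ℝ) * α)
    rw [← h2]
    generalize ((q ^ (-(n : ℝ) * α) : ℝ) : ℂ) = y at h3 ⊢
    field_simp
  have hrq : -(q : ℂ) ^ (n + 2) / ((t2 * ((q ^ (-(n : ℝ) * γ) : ℝ) : ℂ)) *
      (t3 * ((q ^ (-(n : ℝ) * δ) : ℝ) : ℂ))) =
      ((q : ℂ) ^ n) ^ 2 * (-(q : ℂ) ^ 2 / (t2 * t3)) := by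
    rw [hpair _ _ _ ht2 ht3, hγδ, mul_one, Real.rpow_natCast, pow_add]
    push_cast
    ring
  have hxz : t1 * ((q ^ (-(n : ℝ) * β) : ℝ) : ℂ) * (((q ^ (-(n : ℝ) * α) : ℝ) : ℂ) * z) =
      t1 * ((q ^ (-(n : ℝ) * β) : ℝ) : ℂ) * (z * ((q ^ (-(n : ℝ) * α) : ℝ) : ℂ)) := by ring
  have hws : z / t1 * (-(q : ℂ) ^ 2 / (t2 * t3)) = -((q : ℂ) ^ 2 * z / (t1 * t2 * t3)) := by
    field_simp
  have hqn : (q : ℂ) ^ n ≠ 0 := pow_ne_zero _ hqC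
  rw [VzC, ← mul_assoc, ← mul_assoc, hpre, one_mul, Finset.mul_sum, hwq, hrq, hxz, ramanujanAqC,
    zpow_neg, zpow_natCast]
  set A := fun k : ℕ => qpC q (-(q : ℂ) ^ 2 / ((t1 * ((q ^ (-(n : ℝ) * β) : ℝ) : ℂ)) *
    (t3 * ((q ^ (-(n : ℝ) * δ) : ℝ) : ℂ)))) k
  set B := qpC q (-(q : ℂ) ^ 2 / ((t2 * ((q ^ (-(n : ℝ) * γ) : ℝ) : ℂ)) *
    (t3 * ((q ^ (-(n : ℝ) * δ) : ℝ) : ℂ)))) n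
  set X := fun k : ℕ => qpC q (-(q : ℂ) / ((t1 * ((q ^ (-(n : ℝ) * β) : ℝ) : ℂ)) *
    (z * ((q ^ (-(n : ℝ) * α) : ℝ) : ℂ)))) k
  set E := fun k : ℕ => qpC q (-(q : ℂ) ^ 2 / ((t1 * ((q ^ (-(n : ℝ) * β) : ℝ) : ℂ)) *
    (t2 * ((q ^ (-(n : ℝ) * γ) : ℝ) : ℂ)))) k
  set Y := fun k : ℕ => qpC q (q * ((q : ℂ) ^ n / (q : ℂ) ^ k)) k *
    qpC q ((z / t1)⁻¹ * ((q : ℂ) ^ n / (q : ℂ) ^ k)) k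
  have hRn : ∀ k, ‖A n / B * (X k / (A k * E k)) - 1‖ ≤ K * ε n := fun k => by
    have h := hn₀ n hn k (Set.mem_univ k)
    rwa [Real.norm_of_nonneg hεn.le] at h
  have hterm : ∀ k, A n / B * (qpC q ((q : ℂ) ^ n)⁻¹ k * X k *
      qpC q (q * (z / t1) / (q : ℂ) ^ n) k / (qpC q (q : ℂ) k * A k * E k) *
      (((q : ℂ) ^ n) ^ 2 * (-(q : ℂ) ^ 2 / (t2 * t3))) ^ k) =
      (q : ℂ) ^ (k ^ 2) * (-((q : ℂ) ^ 2 * z / (t1 * t2 * t3))) ^ k / qpC q (q : ℂ) k *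
        (A n / B * (X k / (A k * E k)) * Y k) := fun k => by
    have h := qpC_inv_mul_qpC_mul_pow hq0.ne' hqn (div_ne_zero hz ht1)
      (-(q : ℂ) ^ 2 / (t2 * t3)) k
    rw [hws] at h
    calc _ = A n / B * (X k / (A k * E k)) / qpC q (q : ℂ) k * (qpC q ((q : ℂ) ^ n)⁻¹ k *
          qpC q (q * (z / t1) / (q : ℂ) ^ n) k *
          (((q : ℂ) ^ n) ^ 2 * (-(q : ℂ) ^ 2 / (t2 * t3))) ^ k) := by ring
      _ = _ := by rw [h]; ring
  have hbound := norm_sum_mul_sub_tsum_le hq0 hq1 hsum (n := n) (e := ε n)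
    (K := K * (1 + L) + L) (g := fun k => A n / B * (X k / (A k * E k)) * Y k)
    (by positivity) hqε fun k hk => by
      have hqk : 0 < q ^ k := pow_pos hq0 k
      have hu : ‖(q : ℂ) ^ n / (q : ℂ) ^ k‖ = q ^ n / q ^ k := by
        rw [norm_div, norm_pow, norm_pow, Complex.norm_real, Real.norm_of_nonneg hq0.le]
      have hu1 : q ^ n / q ^ k ≤ 1 :=
        (div_le_one hqk).2 (pow_le_pow_of_le_one hq0.le hq1.le hk)
      have hYk := hY _ (hu.trans_le hu1) k
      rw [hu] at hYk
      refine (norm_mul_sub_one_le (hRn k) hYk).trans ?_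
      have h1 : K * ε n * (1 + L * (q ^ n / q ^ k)) ≤ K * (ε n / q ^ k) * (1 + L * 1) := by
        gcongr
        exact le_div_self hεn.le hqk (pow_le_one₀ hq0.le hq1.le)
      have h2 : L * (q ^ n / q ^ k) ≤ L * (ε n / q ^ k) := by gcongr
      linarith
  refine (le_of_eq ?_).trans (hbound.trans ?_)
  · congr 2
    exact Finset.sum_congr rfl fun k _ => hterm k
  · have : (K * (1 + L) + L + 1) * ε n * S ≤ ((K * (1 + L) + L + 1) * S + 1) * ε n := by
      linarith
    exact this
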